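/- For an algebraically consistent dimer model Γ, the unsigned version of the dimer superpotential coincides with the superpotential of the collection E: \bar{W}_Γ := Σ_{F∈Q₂} w_F = Σ_p p, where the sum on the right is over all anticanonical cycles p in Q. In particular, J_W = J_E = (∂_a W_Γ : a ∈ Q₁), so the toric algebra A_E is consistent. -/

import Mathlib

namespace NCCell
/-- Toric data for a normal affine toric variety `X = Spec k[σ^∨ ∩ M]` of dimension `n`
with a torus-invariant point: the strongly convex, full-dimensional rational cone
`σ ⊆ ℝⁿ` is recorded through the primitive generators `v ρ` of its `d` extremal rays. -/
structure ToricData (n d : ℕ) where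
  v : Fin d → Fin n → ℤ
  primitive : ∀ ρ, Finset.univ.gcd (fun i => (v ρ i).natAbs) = 1
  strongly_convex : ∃ u : Fin n → ℤ, ∀ ρ, 0 < ∑ i, u i * v ρ i
  full_dim : ∀ u : Fin n → ℤ, (∀ ρ, ∑ i, u i * v ρ i = 0) → u = 0
  extremal_rays : ∀ ρ : Fin d, ∃ u : Fin n → ℤ,
    (∑ i, u i * v ρ i = 0) ∧ ∀ ρ', ρ' ≠ ρ → 0 < ∑ i, u i * v ρ' i

namespace ToricData
variable {n d : ℕ} (T : ToricData n d)
/-- The inclusion `M = ℤⁿ → ℤᵈ`, `u ↦ (⟨u, v_ρ⟩)_ρ`, from the exact sequence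
`0 → M → ℤᵈ → Cl(X) → 0`. -/
def iota : (Fin n → ℤ) →+ (Fin d → ℤ) where
  toFun u := fun ρ => ∑ i, u i * T.v ρ i
  map_zero' := by funext ρ; simp
  map_add' u w := by funext ρ; simp [add_mul, Finset.sum_add_distrib]
/-- The sublattice of `ℤᵈ` of principal torus-invariant Weil divisors, i.e. the image
of `M`; the class group `Cl(X)` is the quotient `ℤᵈ ⧸ prin`. -/
def prin : AddSubgroup (Fin d → ℤ) := T.iota.range
/-- `X` is Gorenstein: `(1,…,1)` lies in (the image of) `M`. -/
def Gorenstein : Prop := (fun _ => 1 : Fin d → ℤ) ∈ T.prin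
end ToricData

def toInt {d : ℕ} (u : Fin d → ℕ) : Fin d → ℤ := fun ρ => (u ρ : ℤ)

/-- A collection of distinct rank one reflexive sheaves on `X`, recorded through Weil
divisor representatives `D i` of their divisor classes. -/
structure Collection {n d : ℕ} (T : ToricData n d) (I : Type*) where
  D : I → Fin d → ℤ
  distinct : ∀ i j : I, D i - D j ∈ T.prin → i = j

namespace Collection
section
variable {n d : ℕ} {T : ToricData n d} {I : Type*} (C : Collection T I)
/-- `u ∈ ℕᵈ` is (the divisor of zeroes of) a torus-invariant section of
`Hom(E_i, E_j) = H⁰(X, O_X(D_j - D_i))`, i.e. `u` is effective of class `[D_j - D_i]`. -/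
def IsSection (i j : I) (u : Fin d → ℕ) : Prop :=
  toInt u - (C.D j - C.D i) ∈ T.prin
/-- A torus-invariant section is irreducible if it admits no nontrivial factorisation
through a member of the collection. -/
def IsIrreducible (i j : I) (u : Fin d → ℕ) : Prop :=
  C.IsSection i j u ∧
    ∀ (l : I) (u₁ u₂ : Fin d → ℕ), u = u₁ + u₂ →
      C.IsSection i l u₂ → C.IsSection l j u₁ →
      (l = i ∧ u₂ = 0) ∨ (l = j ∧ u₁ = 0)
/-- An arrow of the quiver of sections `Q` of the collection: an irreducible
torus-invariant section, with its head, tail and labelling divisor `div(a) ∈ ℕᵈ`. -/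
structure Arrow where
  src : I
  tgt : I
  lab : Fin d → ℕ
  irred : C.IsIrreducible src tgt lab
  nontriv : ¬ (src = tgt ∧ lab = 0)
/-- Paths in the quiver of sections (`nil i` is the trivial path `e_i`, and
`cons p a _` is the path `a·p`, i.e. `a` traversed last). -/
inductive Path : I → I → Type _
  | nil (i : I) : Path i i
  | cons {i j : I} (p : Path i j) (a : C.Arrow) (h : a.src = j) : Path i a.tgt
end

section
variable {n d : ℕ} {T : ToricData n d} {I : Type*} {C : Collection T I}
/-- The labelling divisor `div(p) ∈ ℕᵈ` of a path. -/
def Path.lab {i : I} : {j : I} → C.Path i j → (Fin d → ℕ)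
  | _, .nil _ => 0
  | _, .cons p a _ => Path.lab p + a.lab
/-- Composition of paths: `p.comp q` traverses `p` first, then `q`. -/
def Path.comp {i j : I} (p : C.Path i j) : {l : I} → C.Path j l → C.Path i l
  | _, .nil _ => p
  | _, .cons q a h => .cons (Path.comp p q) a h
/-- The arrow traversed last by a path. -/
def Path.lastArrow? {i : I} : {j : I} → C.Path i j → Option (C.Arrow)
  | _, .nil _ => none
  | _, .cons _ a _ => some a
/-- The arrow traversed first by a path. -/
def Path.firstArrow? {i : I} : {j : I} → C.Path i j → Option (C.Arrow)
  | _, .nil _ => none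
  | _, .cons p a _ => some ((Path.firstArrow? p).getD a)
/-- The list of arrows traversed by a path (last traversed first). -/
def Path.arrows {i : I} : {j : I} → C.Path i j → List (C.Arrow)
  | _, .nil _ => []
  | _, .cons p a _ => a :: Path.arrows p

/-- `pp - pm` is one of the generating relations of the ideal of superpotential
relations `J_W`: there is a path `q` such that the derivative `∂_q W` of the
superpotential `W = Σ_{p anticanonical cycle} p` is the sum of precisely the two paths
`pp` and `pm`, and these two paths share neither initial nor final arrow.  (Here
`∂_q W` is the sum of all paths `p` with tail at `h(q)`, head at `t(q)` and labelling
monomial `x^{div p} = Π_ρ x_ρ / x^{div q}`.) -/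
def IsSPRel {i j : I} (pp pm : C.Path i j) : Prop :=
  ∃ q : C.Path j i,
    (∀ ρ, pp.lab ρ + q.lab ρ = 1) ∧ (∀ ρ, pm.lab ρ + q.lab ρ = 1) ∧
    pp ≠ pm ∧
    pp.firstArrow? ≠ pm.firstArrow? ∧ pp.lastArrow? ≠ pm.lastArrow? ∧
    (∀ p : C.Path i j, (∀ ρ, p.lab ρ + q.lab ρ = 1) → p = pp ∨ p = pm)

/-- F-term equivalence of paths: the equivalence relation generated by
`q₂ p₊ q₁ ∼ q₂ p₋ q₁` for superpotential relations `p₊ - p₋ ∈ J_W`.  Two paths are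
identified in the superpotential algebra `A_W = kQ/J_W` iff they are F-term equivalent. -/
inductive FTermEquiv : {i j : I} → C.Path i j → C.Path i j → Prop
  | rel {i j l m : I} {pp pm : C.Path i j} (q₁ : C.Path l i) (q₂ : C.Path j m)
      (h : IsSPRel pp pm) :
      FTermEquiv ((q₁.comp pp).comp q₂) ((q₁.comp pm).comp q₂)
  | refl {i j : I} (p : C.Path i j) : FTermEquiv p p
  | symm {i j : I} {p q : C.Path i j} : FTermEquiv p q → FTermEquiv q p
  | trans {i j : I} {p q r : C.Path i j} : FTermEquiv p q → FTermEquiv q r → FTermEquiv p r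
end

/-- The toric algebra `A_𝓔 = kQ/J_𝓔` is consistent, i.e. `J_𝓔 = J_W`: since (classes of)
paths form bases of both quotient algebras, this says precisely that two paths of `Q`
with the same head and tail are identified in `A_𝓔` (i.e. share the same labelling
divisor) if and only if they are identified in `A_W` (i.e. are F-term equivalent). -/
def Consistent {n d : ℕ} {T : ToricData n d} {I : Type*} (C : Collection T I) : Prop :=
  ∀ (i j : I) (p q : C.Path i j), p.lab = q.lab ↔ FTermEquiv p q

end Collection
end NCCell

namespace NCCell

/-- A dimer model `Γ` on a real two-torus, recorded through the dual quiver `Q`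
embedded in the torus: `src`/`tgt` give the quiver structure on the dual cell
decomposition, and `nw` (resp. `nb`) sends an arrow to the next arrow around the
boundary of the unique white (resp. black) face containing it; faces of `Q` are the
orbits of `nw` and `nb`. -/
structure DimerStruct (V A : Type) where
  src : A → V
  tgt : A → V
  nw : Equiv.Perm A
  nb : Equiv.Perm A
  nw_src : ∀ a, src (nw a) = tgt a
  nb_src : ∀ a, src (nb a) = tgt a

namespace DimerStruct

variable {V A : Type}

/-- The number of cycles (orbits, including fixed points) of a permutation. -/
noncomputable def numCycles [Fintype A] [DecidableEq A] (σ : Equiv.Perm A) : ℕ :=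
  Multiset.card σ.cycleType + (Finset.univ.filter fun a => σ a = a).card

/-- The quiver `Q`, together with its white and black faces, is a polygonal cell
decomposition of a real two-torus: the Euler characteristic
`#Q₀ - #Q₁ + #Q₂ = 0` vanishes, every vertex meets an arrow, each face is an
embedded polygon (its boundary traverses no arrow twice), arrows are not loops, and
the quiver is connected (via the face structure this makes `|Q|` a torus). -/
def IsTorusDimer [Fintype V] [Fintype A] [DecidableEq V] [DecidableEq A]
    (D : DimerStruct V A) : Prop :=
  Fintype.card V + (numCycles D.nw + numCycles D.nb) = Fintype.card A
  ∧ (∀ v : V, ∃ a, D.src a = v)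
  ∧ (∀ a : A, D.src a ≠ D.tgt a)
  ∧ (∀ a : A, Function.Injective fun m : Fin (Function.minimalPeriod (⇑D.nw) a) => (⇑D.nw)^[m] a)
  ∧ (∀ a : A, Function.Injective fun m : Fin (Function.minimalPeriod (⇑D.nb) a) => (⇑D.nb)^[m] a)

/-- The path `p_a⁺` completing the arrow `a` to the boundary cycle of its white face:
it runs from `tgt a` back to `src a` (listed in traversal order). -/
noncomputable def wpath (D : DimerStruct V A) (a : A) : List A :=
  (List.range (Function.minimalPeriod (⇑D.nw) a - 1)).map fun m => (⇑D.nw)^[m + 1] a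

/-- The path `p_a⁻` completing the arrow `a` to the boundary cycle of its black face. -/
noncomputable def bpath (D : DimerStruct V A) (a : A) : List A :=
  (List.range (Function.minimalPeriod (⇑D.nb) a - 1)).map fun m => (⇑D.nb)^[m + 1] a

/-- The boundary cycle `w_F` of the white face of `a`, based at `src a` and starting
with `a` (in traversal order). -/
noncomputable def wcyc (D : DimerStruct V A) (a : A) : List A := a :: D.wpath a

/-- The boundary cycle of the black face of `a`, based at `src a`. -/
noncomputable def bcyc (D : DimerStruct V A) (a : A) : List A := a :: D.bpath a

/-- `IsPathFrom u l w`: the list of arrows `l` (in traversal order) is a path in the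
quiver from `u` to `w`. -/
def IsPathFrom (D : DimerStruct V A) : V → List A → V → Prop
  | u, [], w => u = w
  | u, a :: l, w => D.src a = u ∧ IsPathFrom D (D.tgt a) l w

/-- The vector `v(l) ∈ ℤ^{Q₁}` of multiplicities of a path. -/
noncomputable def cnt (l : List A) : A →₀ ℤ :=
  (l.map fun a => Finsupp.single a (1 : ℤ)).sum

/-- F-term equivalence of paths (recorded with their source vertices) of the dimer
model: the equivalence relation generated by replacing `p_a⁺` by `p_a⁻` in any path
context, i.e. by the F-term relations `∂_a W_Γ = p_a⁺ - p_a⁻`. -/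
inductive FTerm (D : DimerStruct V A) : V × List A → V × List A → Prop
  | rel (u : V) (l₁ l₂ : List A) (a : A) :
      FTerm D (u, l₁ ++ D.wpath a ++ l₂) (u, l₁ ++ D.bpath a ++ l₂)
  | refl (x) : FTerm D x x
  | symm {x y} : FTerm D x y → FTerm D y x
  | trans {x y z} : FTerm D x y → FTerm D y z → FTerm D x z

/-- Algebraic consistency of the dimer model (Broomhead): the superpotential algebra
`A_Γ = kQ/(∂_a W_Γ)` is isomorphic to the toric algebra constructed from the toric
data encoded by `Γ`; equivalently, two paths of `Q` with the same source and target
are F-term equivalent whenever their multiplicity vectors agree modulo the subgroup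
generated by the vectors `v(p_a⁺) - v(p_a⁻)` of the F-term relations. -/
def AlgConsistent (D : DimerStruct V A) : Prop :=
  ∀ (u w : V) (l l' : List A), D.IsPathFrom u l w → D.IsPathFrom u l' w →
    cnt l - cnt l' ∈
      AddSubgroup.closure {x : A →₀ ℤ | ∃ a, x = cnt (D.wpath a) - cnt (D.bpath a)} →
    FTerm D (u, l) (u, l')

/-- A perfect matching of the dimer model `Γ`, described dually: a set of arrows
containing precisely one arrow of the boundary of each (white or black) face of `Q`
— i.e. a set of edges of `Γ` covering each vertex of the bipartite graph exactly once. -/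
def IsPerfectMatching (D : DimerStruct V A) (S : Set A) : Prop :=
  (∀ a : A, ∃! b, D.nw.SameCycle a b ∧ b ∈ S) ∧
  (∀ a : A, ∃! b, D.nb.SameCycle a b ∧ b ∈ S)

end DimerStruct
end NCCell

open NCCell DimerStruct Collection

section
variable {V A : Type} [Fintype V] [Fintype A] [DecidableEq V] [DecidableEq A]

/-- The label sum `div(l) ∈ ℕᵈ` of a path of the dimer quiver, computed through an
identification `φ` of its arrows with the arrows of a quiver of sections. -/
def labSum {n d : ℕ} {T : ToricData n d} {C : Collection T V}
    (φ : A ≃ C.Arrow) (l : List A) : Fin d → ℕ :=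
  fun ρ => (l.map fun a => (φ a).lab ρ).sum

end

namespace NCCell.DimerStruct

section Cycles

variable {V A : Type}

/-- The cycle of the permutation `f` through `a`, with `a` itself removed. -/
noncomputable def cycleTail (f : Equiv.Perm A) (a : A) : List A :=
  (List.range (Function.minimalPeriod (⇑f) a - 1)).map fun m => (⇑f)^[m + 1] a

lemma isPathFrom_append (D : DimerStruct V A) (u w : V) (l l' : List A) :
    D.IsPathFrom u (l ++ l') w ↔ ∃ x, D.IsPathFrom u l x ∧ D.IsPathFrom x l' w := by
  induction l generalizing u with
  | nil => simp [IsPathFrom]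
  | cons a l ih => simp [IsPathFrom, ih, and_assoc]

/-- `f` is one of the two permutations rotating the faces of the dimer model. -/
def IsFacePerm (D : DimerStruct V A) (f : Equiv.Perm A) : Prop := f = D.nw ∨ f = D.nb

lemma IsFacePerm.src_apply {D : DimerStruct V A} {f : Equiv.Perm A} (hf : D.IsFacePerm f)
    (a : A) : D.src (f a) = D.tgt a := by
  rcases hf with rfl | rfl
  exacts [D.nw_src a, D.nb_src a]

/-- A weight on arrows with equal sums over the two completions of every arrow is an
invariant of F-term equivalence. -/
lemma FTerm.sum_eq {D : DimerStruct V A} {π : A → ℕ}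
    (hπ : ∀ a, ((cycleTail D.nw a).map π).sum = ((cycleTail D.nb a).map π).sum)
    {x y : V × List A} (h : FTerm D x y) : (x.2.map π).sum = (y.2.map π).sum := by
  induction h with
  | rel u l₁ l₂ a =>
    have := hπ a
    change ((l₁ ++ cycleTail D.nw a ++ l₂).map π).sum = ((l₁ ++ cycleTail D.nb a ++ l₂).map π).sum
    simp only [List.map_append, List.sum_append, this]
  | refl x => rfl
  | symm _ ih => exact ih.symm
  | trans _ _ ih ih' => exact ih.trans ih'

variable [Fintype A]

lemma mem_periodicPts_perm (f : Equiv.Perm A) (a : A) : a ∈ Function.periodicPts f :=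
  f.injective.mem_periodicPts a

lemma minimalPeriod_perm_pos (f : Equiv.Perm A) (a : A) : 0 < Function.minimalPeriod f a :=
  Function.minimalPeriod_pos_of_mem_periodicPts (mem_periodicPts_perm f a)

lemma cons_cycleTail (f : Equiv.Perm A) (a : A) :
    a :: cycleTail f a = (List.range (Function.minimalPeriod f a)).map fun m => (⇑f)^[m] a := by
  obtain ⟨k, hk⟩ := Nat.exists_eq_add_one.2 (minimalPeriod_perm_pos f a)
  simp [cycleTail, hk, List.range_succ_eq_map, Function.comp_def]

lemma cycleTail_append (f : Equiv.Perm A) (a : A) :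
    cycleTail f a ++ [a] = f a :: cycleTail f (f a) := by
  rw [cons_cycleTail, Function.minimalPeriod_apply (mem_periodicPts_perm f a)]
  have h := Function.iterate_minimalPeriod (f := f) (x := a)
  obtain ⟨k, hk⟩ := Nat.exists_eq_add_one.2 (minimalPeriod_perm_pos f a)
  rw [hk] at h
  rw [cycleTail, hk, List.range_succ, List.map_append]
  simp only [Nat.add_sub_cancel, List.map_cons, List.map_nil, ← Function.iterate_succ_apply, h]

lemma cycleTail_eq_cons (f : Equiv.Perm A) (a : A) (h : f a ≠ a) :
    ∃ r, cycleTail f a = f a :: r := by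
  have h1 : Function.minimalPeriod f a ≠ 1 := fun e =>
    h (Function.minimalPeriod_eq_one_iff_isFixedPt.1 e)
  obtain ⟨k, hk⟩ : ∃ k, Function.minimalPeriod f a - 1 = k + 1 :=
    Nat.exists_eq_add_one.2 (by have := minimalPeriod_perm_pos f a; omega)
  exact ⟨_, by rw [cycleTail, hk, List.range_succ_eq_map, List.map_cons]; rfl⟩

lemma sum_cons_cycleTail (f : Equiv.Perm A) (a : A) (h : A → ℕ) [DecidablePred (f.SameCycle a)] :
    ((a :: cycleTail f a).map h).sum = ∑ b with f.SameCycle a b, h b := by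
  classical
  have hnd : (a :: cycleTail f a).Nodup := by
    rw [cons_cycleTail]
    exact Cycle.nodup_coe_iff.1 Function.nodup_periodicOrbit
  rw [← List.sum_toFinset h hnd]
  refine Finset.sum_congr ?_ fun _ _ => rfl
  ext b
  have hb : b ∈ a :: cycleTail f a ↔ ∃ n, (⇑f)^[n] a = b := by
    rw [cons_cycleTail]
    exact Function.mem_periodicOrbit_iff (mem_periodicPts_perm f a)
  rw [List.mem_toFinset, hb, Finset.mem_filter_univ]
  constructor
  · rintro ⟨n, rfl⟩
    exact ⟨n, by rw [zpow_natCast, Equiv.Perm.iterate_eq_pow]⟩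
  · intro h
    obtain ⟨n, -, hn⟩ := h.exists_pow_eq'
    exact ⟨n, by rw [Equiv.Perm.iterate_eq_pow, hn]⟩

lemma IsFacePerm.isPathFrom_cycleTail {D : DimerStruct V A} {f : Equiv.Perm A}
    (hf : D.IsFacePerm f) (a : A) : D.IsPathFrom (D.tgt a) (cycleTail f a) (D.src a) := by
  have key : ∀ (k : ℕ), D.IsPathFrom (D.src (f a))
      ((List.range k).map fun m => (⇑f)^[m + 1] a) (D.src ((⇑f)^[k + 1] a)) := by
    intro k
    induction k with
    | zero => simp [IsPathFrom]
    | succ k ih =>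
      rw [List.range_succ, List.map_append, isPathFrom_append]
      refine ⟨_, ih, ?_⟩
      simp only [List.map_cons, List.map_nil, IsPathFrom, true_and]
      rw [Function.iterate_succ_apply' _ (k + 1), hf.src_apply]
  have h := key (Function.minimalPeriod f a - 1)
  rw [Nat.sub_add_cancel (minimalPeriod_perm_pos f a), Function.iterate_minimalPeriod,
    hf.src_apply] at h
  exact h

lemma IsFacePerm.isPathFrom_cons_cycleTail {D : DimerStruct V A} {f : Equiv.Perm A}
    (hf : D.IsFacePerm f) (a : A) : D.IsPathFrom (D.src a) (a :: cycleTail f a) (D.src a) :=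
  ⟨rfl, hf.isPathFrom_cycleTail a⟩

lemma isPathFrom_cycleTail_iff {D : DimerStruct V A} (hloop : ∀ a, D.src a ≠ D.tgt a)
    {f : Equiv.Perm A} (hf : D.IsFacePerm f) (a : A) (x y : V) :
    D.IsPathFrom x (cycleTail f a) y ↔ x = D.tgt a ∧ y = D.src a := by
  constructor
  · intro hp
    obtain ⟨r, hr⟩ := cycleTail_eq_cons f a fun e => hloop a (by rw [← hf.src_apply, e])
    have hc := hf.isPathFrom_cycleTail a
    have det : ∀ (l : List A) u v w, D.IsPathFrom u l v → D.IsPathFrom u l w → v = w := by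
      intro l
      induction l with
      | nil => intro u v w h h'; exact h.symm.trans h'
      | cons b l ih => intro u v w h h'; exact ih _ _ _ h.2 h'.2
    have hx : x = D.tgt a := by
      rw [hr] at hp hc
      exact hp.1.symm.trans hc.1
    subst hx
    exact ⟨rfl, det _ _ _ _ hp hc⟩
  · rintro ⟨rfl, rfl⟩
    exact hf.isPathFrom_cycleTail a

/-- F-term equivalent lists of arrows are paths between the same vertices. -/
lemma FTerm.isPathFrom_iff {D : DimerStruct V A} (hloop : ∀ a, D.src a ≠ D.tgt a)
    {x y : V × List A} (h : FTerm D x y) (u w : V) :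
    D.IsPathFrom u x.2 w ↔ D.IsPathFrom u y.2 w := by
  induction h with
  | rel v l₁ l₂ a =>
    have hw := isPathFrom_cycleTail_iff hloop (Or.inl rfl : D.IsFacePerm D.nw) a
    have hb := isPathFrom_cycleTail_iff hloop (Or.inr rfl : D.IsFacePerm D.nb) a
    change D.IsPathFrom u (l₁ ++ cycleTail D.nw a ++ l₂) w ↔
      D.IsPathFrom u (l₁ ++ cycleTail D.nb a ++ l₂) w
    simp only [isPathFrom_append, hw, hb]
  | refl x => rfl
  | symm _ ih => exact ih.symm
  | trans _ _ ih ih' => exact ih.trans ih'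

/-- A function constant along all faces takes the same value on the first arrows of
F-term equivalent paths. -/
lemma FTerm.head?_eq {D : DimerStruct V A} (hloop : ∀ a, D.src a ≠ D.tgt a) {X : Type*}
    {g : A → X} (hw : ∀ a, g (D.nw a) = g a) (hb : ∀ a, g (D.nb a) = g a)
    {x y : V × List A} (h : FTerm D x y) : x.2.head?.map g = y.2.head?.map g := by
  induction h with
  | rel u l₁ l₂ a =>
    change (l₁ ++ cycleTail D.nw a ++ l₂).head?.map g = (l₁ ++ cycleTail D.nb a ++ l₂).head?.map g
    obtain ⟨r, hr⟩ := cycleTail_eq_cons D.nw a fun e => hloop a (by rw [← D.nw_src, e])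
    obtain ⟨r', hr'⟩ := cycleTail_eq_cons D.nb a fun e => hloop a (by rw [← D.nb_src, e])
    cases l₁ with
    | nil => simp [hr, hr', hw, hb]
    | cons b l₁ => simp
  | refl x => rfl
  | symm _ ih => exact ih.symm
  | trans _ _ ih ih' => exact ih.trans ih'

end Cycles

section Matching

/-- A nonzero regular weight on the edges of a finite bipartite multigraph dominates, up to
support, the indicator weight of a perfect matching. -/
lemma exists_matching_of_regular {A W B : Type*} [Fintype A] [Fintype W] [Fintype B]
    [DecidableEq W] [DecidableEq B] (p : A → W) (q : A → B) (h : A → ℕ) {n : ℕ} (hn : 0 < n)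
    (hp : ∀ w, ∑ a with p a = w, h a = n) (hq : ∀ b, ∑ a with q a = b, h a = n) :
    ∃ π : A → ℕ, (∀ a, h a = 0 → π a = 0) ∧ (∀ w, ∑ a with p a = w, π a = 1) ∧
      ∀ b, ∑ a with q a = b, π a = 1 := by
  classical
  let t : W → Finset B := fun w => (Finset.univ.filter fun a => p a = w ∧ h a ≠ 0).image q
  have hall : ∀ s : Finset W, s.card ≤ (s.biUnion t).card := by
    intro s
    refine Nat.le_of_mul_le_mul_right ?_ hn
    calc s.card * n = ∑ w ∈ s, ∑ a with p a = w, h a := by simp [hp]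
      _ = ∑ a with p a ∈ s, h a := by
        rw [← Finset.sum_fiberwise_of_maps_to (s := Finset.univ.filter fun a => p a ∈ s)
          (t := s) (g := p) (by simp)]
        refine Finset.sum_congr rfl fun w hw => Finset.sum_congr ?_ fun _ _ => rfl
        ext a
        simp only [Finset.mem_filter, Finset.mem_univ, true_and]
        exact ⟨fun e => ⟨e ▸ hw, e⟩, fun e => e.2⟩
      _ ≤ ∑ a with q a ∈ s.biUnion t, h a := by
        rw [← Finset.sum_filter_ne_zero]
        refine Finset.sum_le_sum_of_subset fun a ha => ?_
        simp only [Finset.mem_filter, Finset.mem_univ, true_and] at ha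
        simp only [Finset.mem_filter, Finset.mem_univ, true_and, Finset.mem_biUnion]
        exact ⟨p a, ha.1, Finset.mem_image.2 ⟨a, by simp [ha.2], rfl⟩⟩
      _ = ∑ b ∈ s.biUnion t, ∑ a with q a = b, h a := by
        rw [← Finset.sum_fiberwise_of_maps_to
          (s := Finset.univ.filter fun a => q a ∈ s.biUnion t)
          (t := s.biUnion t) (g := q) (by simp)]
        refine Finset.sum_congr rfl fun w hw => Finset.sum_congr ?_ fun _ _ => rfl
        ext a
        simp only [Finset.mem_filter, Finset.mem_univ, true_and]
        exact ⟨fun e => e.2, fun e => ⟨e ▸ hw, e⟩⟩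
      _ = (s.biUnion t).card * n := by simp [hq]
  obtain ⟨m, hminj, hmt⟩ := (Finset.all_card_le_biUnion_card_iff_exists_injective t).1 hall
  have hcard : Fintype.card W = Fintype.card B := by
    have h1 : ∑ a, h a = Fintype.card W * n := by
      rw [← Finset.sum_fiberwise Finset.univ p h]; simp [hp]
    have h2 : ∑ a, h a = Fintype.card B * n := by
      rw [← Finset.sum_fiberwise Finset.univ q h]; simp [hq]
    exact Nat.eq_of_mul_eq_mul_right hn (h1.symm.trans h2)
  have hmbij : Function.Bijective m := (Fintype.bijective_iff_injective_and_card m).2 ⟨hminj, hcard⟩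
  have hex : ∀ w, ∃ a, (p a = w ∧ h a ≠ 0) ∧ q a = m w := by
    intro w
    simpa [t] using hmt w
  choose e he heq using hex
  refine ⟨fun a => if a = e (p a) then 1 else 0, ?_, ?_, ?_⟩
  · intro a ha
    refine if_neg fun hae => (he (p a)).2 ?_
    rw [← hae, ha]
  · intro w
    rw [Finset.sum_eq_single (e w)]
    · simp [(he w).1]
    · intro a ha hne
      simp only [Finset.mem_filter, Finset.mem_univ, true_and] at ha
      exact if_neg (by rw [ha]; exact hne)
    · intro hna
      exact absurd (by simp [(he w).1]) hna
  · intro b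
    obtain ⟨w, rfl⟩ := hmbij.2 b
    rw [Finset.sum_eq_single (e w)]
    · simp [(he w).1]
    · intro a ha hne
      simp only [Finset.mem_filter, Finset.mem_univ, true_and] at ha
      refine if_neg fun hae => hne ?_
      have : m (p a) = m w := by rw [← heq, ← hae, ha]
      rw [hae, hminj this]
    · intro hna
      exact absurd (by simp [heq]) hna

end Matching

end NCCell.DimerStruct

namespace NCCell.ToricData

lemma exists_nonneg_add_nsmul {d : ℕ} (y z : Fin d → ℤ)
    (h : ∀ ρ, 0 < z ρ ∨ (0 ≤ y ρ ∧ z ρ = 0)) : ∃ N : ℕ, ∀ ρ, 0 ≤ (y + N • z) ρ := by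
  refine ⟨∑ ρ, (y ρ).natAbs, fun ρ => ?_⟩
  have hle : (y ρ).natAbs ≤ ∑ ρ, (y ρ).natAbs :=
    Finset.single_le_sum (f := fun ρ => (y ρ).natAbs) (fun _ _ => Nat.zero_le _)
      (Finset.mem_univ ρ)
  rw [Pi.add_apply, Pi.smul_apply, nsmul_eq_mul]
  generalize (∑ ρ, (y ρ).natAbs) = N at hle
  rcases h ρ with hz | ⟨hy, hz⟩
  · have : (N : ℤ) ≤ N * z ρ := le_mul_of_one_le_right (by positivity) hz
    omega
  · simpa [hz] using hy

variable {n d : ℕ} (T : ToricData n d)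

/-- An additive function on `σ^∨ ∩ M` vanishing on the facet orthogonal to a ray `ρ` is a
multiple of the pairing with the primitive generator of `ρ`. -/
lemma exists_eq_mul_of_vanish (ρ : Fin d) (F : (Fin n → ℤ) → ℕ)
    (hadd : ∀ m m', (∀ ρ', 0 ≤ T.iota m ρ') → (∀ ρ', 0 ≤ T.iota m' ρ') → F (m + m') = F m + F m')
    (hvan : ∀ m, (∀ ρ', 0 ≤ T.iota m ρ') → T.iota m ρ = 0 → F m = 0) :
    ∃ k : ℕ, ∀ m, (∀ ρ', 0 ≤ T.iota m ρ') → F m = (T.iota m ρ).toNat * k := by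
  obtain ⟨m₀, hm₀, hm₀'⟩ := T.extremal_rays ρ
  replace hm₀ : T.iota m₀ ρ = 0 := hm₀
  replace hm₀' : ∀ ρ', ρ' ≠ ρ → 0 < T.iota m₀ ρ' := hm₀'
  have nonneg₀ : ∀ ρ', 0 ≤ T.iota m₀ ρ' := fun ρ' => by
    by_cases h : ρ' = ρ
    · rw [h, hm₀]
    · exact (hm₀' ρ' h).le
  have shift : ∀ m, 0 ≤ T.iota m ρ → ∃ N : ℕ, ∀ ρ', 0 ≤ T.iota (m + N • m₀) ρ' := by
    intro m hm
    obtain ⟨N, hN⟩ := exists_nonneg_add_nsmul (T.iota m) (T.iota m₀) fun ρ' => by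
      by_cases h : ρ' = ρ
      · exact Or.inr ⟨h ▸ hm, h ▸ hm₀⟩
      · exact Or.inl (hm₀' ρ' h)
    exact ⟨N, fun ρ' => by rw [map_add, map_nsmul]; exact hN ρ'⟩
  have hsmul₀ : ∀ N : ℕ, T.iota (N • m₀) ρ = 0 := fun N => by
    rw [map_nsmul, Pi.smul_apply, hm₀, smul_zero]
  obtain ⟨m₁, hm₁⟩ : ∃ m₁, T.iota m₁ ρ = 1 := by
    obtain ⟨g, hg⟩ := Finset.gcd_eq_sum_mul Finset.univ (T.v ρ)
    have h1 : Finset.univ.gcd (T.v ρ) = 1 := by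
      have hp := T.primitive ρ
      rw [← Finset.normalize_gcd, ← normalize_one, normalize_eq_normalize_iff]
      refine ⟨?_, one_dvd _⟩
      rw [← Int.natAbs_dvd, Int.natCast_dvd, Int.natAbs_one, ← hp]
      exact Finset.dvd_gcd fun i hi => Int.natAbs_dvd_natAbs.2 (Finset.gcd_dvd hi)
    refine ⟨g, ?_⟩
    rw [← h1, hg]
    change ∑ i, g i * T.v ρ i = _
    exact Finset.sum_congr rfl fun i _ => mul_comm (g i) (T.v ρ i)
  obtain ⟨N₁, hN₁⟩ := shift m₁ (by omega)
  set m₂ := m₁ + N₁ • m₀ with hm₂def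
  have hm₂ : T.iota m₂ ρ = 1 := by
    rw [hm₂def, map_add, Pi.add_apply, hsmul₀, hm₁, add_zero]
  have nonneg_smul : ∀ (c : ℕ) m, (∀ ρ', 0 ≤ T.iota m ρ') → ∀ ρ', 0 ≤ T.iota (c • m) ρ' := by
    intro c m hm ρ'
    simp only [map_nsmul, Pi.smul_apply]
    exact nsmul_nonneg (hm ρ') c
  have hFsmul : ∀ c : ℕ, F (c • m₂) = c * F m₂ := by
    intro c
    induction c with
    | zero => simpa using hvan 0 (by simp) (by simp)
    | succ c ih => rw [succ_nsmul, hadd _ _ (nonneg_smul c m₂ hN₁) hN₁, ih]; ring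
  refine ⟨F m₂, fun m hm => ?_⟩
  obtain ⟨c, hc⟩ := Int.eq_ofNat_of_zero_le (hm ρ)
  have hz : T.iota (m - c • m₂) ρ = 0 := by
    rw [map_sub, map_nsmul, Pi.sub_apply, Pi.smul_apply, hm₂, hc]
    simp
  obtain ⟨N, hN⟩ := shift (m - c • m₂) hz.ge
  have h1 := hadd m (N • m₀) hm (nonneg_smul N m₀ nonneg₀)
  have h2 := hadd (c • m₂) (m - c • m₂ + N • m₀) (nonneg_smul c m₂ hN₁) hN
  rw [hvan _ (nonneg_smul N m₀ nonneg₀) (hsmul₀ N)] at h1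
  rw [hvan _ hN (by rw [map_add, Pi.add_apply, hz, hsmul₀, add_zero]), hFsmul] at h2
  have h3 : c • m₂ + (m - c • m₂ + N • m₀) = m + N • m₀ := by abel
  rw [h3, h1] at h2
  simpa [hc] using h2

end NCCell.ToricData

namespace NCCell.Collection

variable {V : Type*} {n d : ℕ} {T : ToricData n d} {C : Collection T V}

lemma isSection_zero (i : V) : C.IsSection i i 0 := by
  have h : toInt (0 : Fin d → ℕ) - (C.D i - C.D i) = 0 := by
    funext ρ
    simp [toInt]
  rw [IsSection, h]
  exact zero_mem _

lemma IsSection.add {i j l : V} {x y : Fin d → ℕ} (h : C.IsSection i j x)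
    (h' : C.IsSection j l y) : C.IsSection i l (x + y) := by
  have e : toInt (x + y) - (C.D l - C.D i) =
      (toInt x - (C.D j - C.D i)) + (toInt y - (C.D l - C.D j)) := by
    funext ρ
    simp only [toInt, Pi.sub_apply, Pi.add_apply, Nat.cast_add]
    ring
  rw [IsSection, e]
  exact add_mem h h'

lemma IsSection.eq_of_zero {i j : V} (h : C.IsSection i j 0) : i = j := by
  have e : toInt (0 : Fin d → ℕ) - (C.D j - C.D i) = C.D i - C.D j := by
    funext ρ
    simp [toInt]
  rw [IsSection, e] at h
  exact C.distinct i j h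

lemma Arrow.lab_ne_zero (a : C.Arrow) : a.lab ≠ 0 := fun h =>
  a.nontriv ⟨IsSection.eq_of_zero (h ▸ a.irred.1), h⟩

lemma Arrow.ext_of {a b : C.Arrow} (hs : a.src = b.src) (ht : a.tgt = b.tgt)
    (hl : a.lab = b.lab) : a = b := by
  cases a
  cases b
  simp_all

end NCCell.Collection

namespace NCCell.DimerStruct

section Labels

variable {V A : Type} {D : DimerStruct V A} {n d : ℕ} {T : ToricData n d} {C : Collection T V}
  {φ : A ≃ C.Arrow}

lemma labSum_nil : labSum φ [] = 0 := rfl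

lemma labSum_cons (a : A) (l : List A) : labSum φ (a :: l) = (φ a).lab + labSum φ l := by
  funext ρ
  simp [labSum]

lemma labSum_append (l l' : List A) : labSum φ (l ++ l') = labSum φ l + labSum φ l' := by
  funext ρ
  simp [labSum]

lemma isSection_labSum (hφ : ∀ a : A, (φ a).src = D.src a ∧ (φ a).tgt = D.tgt a) {u w : V}
    {l : List A} (h : D.IsPathFrom u l w) : C.IsSection u w (labSum φ l) := by
  induction l generalizing u with
  | nil => exact (show u = w from h) ▸ isSection_zero u
  | cons a l ih =>
    obtain ⟨rfl, h⟩ := h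
    rw [labSum_cons]
    have ha := (φ a).irred.1
    rw [(hφ a).1, (hφ a).2] at ha
    exact ha.add (ih h)

/-- Every torus-invariant section is the label of a path. -/
lemma exists_path_of_isSection (hφ : ∀ a : A, (φ a).src = D.src a ∧ (φ a).tgt = D.tgt a)
    {u w : V} {x : Fin d → ℕ} (h : C.IsSection u w x) :
    ∃ l, D.IsPathFrom u l w ∧ labSum φ l = x := by
  induction hN : ∑ ρ, x ρ using Nat.strong_induction_on generalizing u w x with
  | _ N ih =>
  by_cases htriv : u = w ∧ x = 0
  · obtain ⟨rfl, rfl⟩ := htriv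
    exact ⟨[], rfl, rfl⟩
  by_cases hirr : C.IsIrreducible u w x
  · let a := φ.symm ⟨u, w, x, hirr, htriv⟩
    have ha : φ a = ⟨u, w, x, hirr, htriv⟩ := φ.apply_symm_apply _
    have hs := hφ a
    rw [ha] at hs
    refine ⟨[a], ⟨hs.1.symm, hs.2.symm⟩, ?_⟩
    rw [labSum_cons, labSum_nil, ha, add_zero]
  · have hex : ∃ (v : V) (x₁ x₂ : Fin d → ℕ), x = x₁ + x₂ ∧ C.IsSection u v x₂ ∧
        C.IsSection v w x₁ ∧ ¬ ((v = u ∧ x₂ = 0) ∨ (v = w ∧ x₁ = 0)) := by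
      by_contra hcon
      refine hirr ⟨h, fun v x₁ x₂ e h₂ h₁ => ?_⟩
      by_contra hne
      exact hcon ⟨v, x₁, x₂, e, h₂, h₁, hne⟩
    obtain ⟨v, x₁, x₂, rfl, h₂, h₁, hne⟩ := hex
    have pos : ∀ y : Fin d → ℕ, y ≠ 0 → 0 < ∑ ρ, y ρ := by
      intro y hy
      refine Nat.pos_of_ne_zero fun h0 => hy ?_
      funext ρ
      exact Finset.sum_eq_zero_iff.1 h0 ρ (Finset.mem_univ ρ)
    have hx₂ := pos x₂ fun e => hne (Or.inl ⟨(IsSection.eq_of_zero (e ▸ h₂)).symm, e⟩)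
    have hx₁ := pos x₁ fun e => hne (Or.inr ⟨IsSection.eq_of_zero (e ▸ h₁), e⟩)
    simp only [Pi.add_apply, Finset.sum_add_distrib] at hN
    obtain ⟨l₂, hl₂, rfl⟩ := ih _ (by omega) h₂ rfl
    obtain ⟨l₁, hl₁, rfl⟩ := ih _ (by omega) h₁ rfl
    exact ⟨l₂ ++ l₁, (isPathFrom_append D _ _ _ _).2 ⟨v, hl₂, hl₁⟩, by
      rw [labSum_append, add_comm]⟩

/-- The quiver of sections is strongly connected. -/
lemma exists_isPathFrom (hφ : ∀ a : A, (φ a).src = D.src a ∧ (φ a).tgt = D.tgt a) (u w : V) :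
    ∃ l, D.IsPathFrom u l w := by
  obtain ⟨m, hm⟩ := T.strongly_convex
  obtain ⟨N, hN⟩ := ToricData.exists_nonneg_add_nsmul (C.D w - C.D u) (T.iota m)
    fun ρ => Or.inl (hm ρ)
  have hs : C.IsSection u w fun ρ => ((C.D w - C.D u + N • T.iota m) ρ).toNat := by
    refine ⟨N • m, ?_⟩
    rw [map_nsmul]
    funext ρ
    have h := Int.toNat_of_nonneg (hN ρ)
    simp only [toInt, Pi.sub_apply] at h ⊢
    rw [h, Pi.add_apply, Pi.sub_apply]
    ring
  obtain ⟨l, hl, -⟩ := exists_path_of_isSection hφ hs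
  exact ⟨l, hl⟩

/-- Every point of `σ^∨ ∩ M` is the label of a cycle at any given vertex. -/
lemma exists_cycle_of_nonneg (hφ : ∀ a : A, (φ a).src = D.src a ∧ (φ a).tgt = D.tgt a) (u : V)
    {m : Fin n → ℤ} (hm : ∀ ρ, 0 ≤ T.iota m ρ) :
    ∃ l, D.IsPathFrom u l u ∧ toInt (labSum φ l) = T.iota m := by
  have e : toInt (fun ρ => (T.iota m ρ).toNat) = T.iota m :=
    funext fun ρ => Int.toNat_of_nonneg (hm ρ)
  have hs : C.IsSection u u fun ρ => (T.iota m ρ).toNat :=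
    ⟨m, by rw [e, sub_self, sub_zero]⟩
  obtain ⟨l, hl, h⟩ := exists_path_of_isSection hφ hs
  exact ⟨l, hl, by rw [h, e]⟩

/-- An arrow is the only path with its endpoints and its label. -/
lemma eq_singleton_of_labSum_eq (hφ : ∀ a : A, (φ a).src = D.src a ∧ (φ a).tgt = D.tgt a)
    (hloop : ∀ a, D.src a ≠ D.tgt a) {b : A} {l : List A}
    (h : D.IsPathFrom (D.src b) l (D.tgt b)) (hl : labSum φ l = (φ b).lab) : l = [b] := by
  cases l with
  | nil => exact absurd h (hloop b)
  | cons c l =>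
    obtain ⟨hc, h⟩ := h
    rw [labSum_cons] at hl
    have h₁ := isSection_labSum hφ h
    have h₂ := (φ c).irred.1
    rw [(hφ c).1, (hφ c).2, hc] at h₂
    have hirr := (φ b).irred
    rw [(hφ b).1, (hφ b).2] at hirr
    rcases hirr.2 _ _ _ (hl.symm.trans (add_comm _ _)) h₂ h₁ with ⟨-, h0⟩ | ⟨ht, h0⟩
    · exact absurd h0 (φ c).lab_ne_zero
    · have hnil : l = [] := by
        cases l with
        | nil => rfl
        | cons a l =>
          rw [labSum_cons] at h0
          refine absurd ?_ (φ a).lab_ne_zero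
          funext ρ
          exact (Nat.add_eq_zero_iff.1 (congrFun h0 ρ)).1
      subst hnil
      rw [labSum_nil, add_zero] at hl
      have : φ c = φ b := Arrow.ext_of (by rw [(hφ c).1, (hφ b).1, hc])
        (by rw [(hφ c).2, (hφ b).2, ht]) hl
      rw [φ.injective this]

variable [Fintype A]

/-- An F-term relation can be applied to a cycle with the label of a face only if the cycle
is itself a face: the context of the relation is a single arrow. -/
lemma context_eq_singleton (hφ : ∀ a : A, (φ a).src = D.src a ∧ (φ a).tgt = D.tgt a)
    (hloop : ∀ a, D.src a ≠ D.tgt a)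
    {ω : Fin d → ℕ} (hω : ∀ f, D.IsFacePerm f → ∀ a, labSum φ (a :: cycleTail f a) = ω)
    {f : Equiv.Perm A} (hf : D.IsFacePerm f) {u : V} {l₁ l₂ : List A} {b : A}
    (hp : D.IsPathFrom u (l₁ ++ cycleTail f b ++ l₂) u)
    (hl : labSum φ (l₁ ++ cycleTail f b ++ l₂) = ω) : l₂ ++ l₁ = [b] := by
  have hlab : labSum φ (l₂ ++ l₁) = (φ b).lab := by
    rw [← hω f hf b, labSum_cons] at hl
    simp only [labSum_append] at hl ⊢
    funext ρ
    have := congrFun hl ρ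
    simp only [Pi.add_apply] at this ⊢
    omega
  rw [isPathFrom_append] at hp
  obtain ⟨y, hp, h₂⟩ := hp
  rw [isPathFrom_append] at hp
  obtain ⟨x, h₁, hc⟩ := hp
  obtain ⟨rfl, rfl⟩ := (isPathFrom_cycleTail_iff hloop hf b x y).1 hc
  exact eq_singleton_of_labSum_eq hφ hloop ((isPathFrom_append _ _ _ _ _).2 ⟨u, h₂, h₁⟩) hlab

/-- Applying an F-term relation to a face cycle yields a face cycle. -/
lemma exists_face_of_context (hφ : ∀ a : A, (φ a).src = D.src a ∧ (φ a).tgt = D.tgt a)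
    (hloop : ∀ a, D.src a ≠ D.tgt a)
    {ω : Fin d → ℕ} (hω : ∀ f, D.IsFacePerm f → ∀ a, labSum φ (a :: cycleTail f a) = ω)
    {f f₂ : Equiv.Perm A} (hf : D.IsFacePerm f) (hf₂ : D.IsFacePerm f₂) {l₁ l₂ : List A} {b : A}
    (h : ∃ g c, D.IsFacePerm g ∧ l₁ ++ cycleTail f b ++ l₂ = c :: cycleTail g c) :
    ∃ g c, D.IsFacePerm g ∧ l₁ ++ cycleTail f₂ b ++ l₂ = c :: cycleTail g c := by
  obtain ⟨g, c, hg, e⟩ := h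
  have hsing := context_eq_singleton hφ hloop hω hf (u := D.src c) (l₁ := l₁) (l₂ := l₂) (b := b)
    (e ▸ hg.isPathFrom_cons_cycleTail c) (e ▸ hω g hg c)
  rcases List.append_eq_singleton_iff.1 hsing with ⟨rfl, rfl⟩ | ⟨rfl, rfl⟩
  · exact ⟨f₂, b, hf₂, by simp⟩
  · exact ⟨f₂, f₂ b, hf₂, by simpa using cycleTail_append f₂ b⟩

/-- A list F-term equivalent to a face cycle is a face cycle. -/
lemma FTerm.isFace_iff (hφ : ∀ a : A, (φ a).src = D.src a ∧ (φ a).tgt = D.tgt a)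
    (hloop : ∀ a, D.src a ≠ D.tgt a)
    {ω : Fin d → ℕ} (hω : ∀ f, D.IsFacePerm f → ∀ a, labSum φ (a :: cycleTail f a) = ω)
    {x y : V × List A} (h : FTerm D x y) :
    (∃ g c, D.IsFacePerm g ∧ x.2 = c :: cycleTail g c) ↔
      ∃ g c, D.IsFacePerm g ∧ y.2 = c :: cycleTail g c := by
  induction h with
  | rel u l₁ l₂ a =>
    exact ⟨exists_face_of_context hφ hloop hω (Or.inl rfl) (Or.inr rfl),
      exists_face_of_context hφ hloop hω (Or.inr rfl) (Or.inl rfl)⟩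
  | refl x => rfl
  | symm _ ih => exact ih.symm
  | trans _ _ ih ih' => exact ih.trans ih'

/-- The complement of a path of length at least two in a cycle with the label of a face admits
no F-term relation. -/
lemma FTerm.eq_of_complement (hφ : ∀ a : A, (φ a).src = D.src a ∧ (φ a).tgt = D.tgt a)
    (hloop : ∀ a, D.src a ≠ D.tgt a)
    {ω : Fin d → ℕ} (hω : ∀ f, D.IsFacePerm f → ∀ a, labSum φ (a :: cycleTail f a) = ω)
    {x y : V × List A} (h : FTerm D x y) {u : V} {a b : A} :
    (D.IsPathFrom u (a :: b :: x.2) u → labSum φ (a :: b :: x.2) = ω → x.2 = y.2) ∧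
      (D.IsPathFrom u (a :: b :: y.2) u → labSum φ (a :: b :: y.2) = ω → x.2 = y.2) := by
  have key : ∀ {f}, D.IsFacePerm f → ∀ (l₁ l₂ : List A) (c : A),
      D.IsPathFrom u (a :: b :: (l₁ ++ cycleTail f c ++ l₂)) u →
      labSum φ (a :: b :: (l₁ ++ cycleTail f c ++ l₂)) = ω → False := by
    intro f hf l₁ l₂ c hp hl
    have := congrArg List.length
      (context_eq_singleton hφ hloop hω hf (l₁ := a :: b :: l₁) (l₂ := l₂) hp hl)
    simp only [List.length_append, List.length_cons, List.length_nil] at this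
    omega
  induction h with
  | rel v l₁ l₂ c =>
    exact ⟨fun hp hl => (key (Or.inl rfl) l₁ l₂ c hp hl).elim,
      fun hp hl => (key (Or.inr rfl) l₁ l₂ c hp hl).elim⟩
  | refl x => exact ⟨fun _ _ => rfl, fun _ _ => rfl⟩
  | symm _ ih => exact ⟨fun hp hl => (ih.2 hp hl).symm, fun hp hl => (ih.1 hp hl).symm⟩
  | trans _ _ ih ih' =>
    refine ⟨fun hp hl => ?_, fun hp hl => ?_⟩
    · have e := ih.1 hp hl
      exact e.trans (ih'.1 (e ▸ hp) (e ▸ hl))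
    · have e := ih'.2 hp hl
      exact (ih.2 (e ▸ hp) (e ▸ hl)).trans e

/-- All faces have the same label. -/
lemma exists_face_label (hφ : ∀ a : A, (φ a).src = D.src a ∧ (φ a).tgt = D.tgt a)
    (hloop : ∀ a, D.src a ≠ D.tgt a)
    (hiso : ∀ (u w : V) (l l' : List A), D.IsPathFrom u l w → D.IsPathFrom u l' w →
      (labSum φ l = labSum φ l' ↔ FTerm D (u, l) (u, l'))) :
    ∃ ω, ∀ f, D.IsFacePerm f → ∀ a, labSum φ (a :: cycleTail f a) = ω := by
  have hnw : D.IsFacePerm D.nw := Or.inl rfl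
  have hnb : D.IsFacePerm D.nb := Or.inr rfl
  have rot : ∀ (f : Equiv.Perm A) a,
      labSum φ (f a :: cycleTail f (f a)) = labSum φ (a :: cycleTail f a) := by
    intro f a
    rw [← cycleTail_append, labSum_append, labSum_cons a (cycleTail f a), labSum_cons, labSum_nil,
      add_zero, add_comm]
  have hwb : ∀ a, labSum φ (a :: cycleTail D.nw a) = labSum φ (a :: cycleTail D.nb a) := by
    intro a
    refine (hiso _ _ _ _ (hnw.isPathFrom_cons_cycleTail a) (hnb.isPathFrom_cons_cycleTail a)).2 ?_
    have h := FTerm.rel (D := D) (D.src a) [a] [] a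
    simp only [List.append_nil, List.singleton_append] at h
    exact h
  let g : A → Fin d → ℕ := fun a => labSum φ (a :: cycleTail D.nw a)
  have hgw : ∀ a, g (D.nw a) = g a := rot D.nw
  have hgb : ∀ a, g (D.nb a) = g a := fun a => by
    simp only [g, hwb]
    exact rot D.nb a
  have hsrc : ∀ a b, D.src a = D.src b → g a = g b := by
    intro a b hab
    have ha := hnw.isPathFrom_cons_cycleTail a
    have hb := hnw.isPathFrom_cons_cycleTail b
    rw [← hab] at hb
    have h := (hiso _ _ _ _ ((isPathFrom_append _ _ _ _ _).2 ⟨_, ha, hb⟩)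
      ((isPathFrom_append _ _ _ _ _).2 ⟨_, hb, ha⟩)).1 (by
        rw [labSum_append, labSum_append, add_comm])
    simpa using h.head?_eq hloop hgw hgb
  have hpath : ∀ (l : List A) a b, D.IsPathFrom (D.src a) l (D.src b) → g a = g b := by
    intro l
    induction l with
    | nil => exact fun a b h => hsrc a b h
    | cons c l ih =>
      intro a b h
      obtain ⟨hc, h⟩ := h
      rw [← D.nw_src] at h
      rw [← hsrc c a hc, ← hgw c]
      exact ih _ _ h
  by_cases hA : Nonempty A
  · obtain ⟨a₀⟩ := hA
    have hconst : ∀ a, g a = g a₀ := fun a => by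
      obtain ⟨l, hl⟩ := exists_isPathFrom hφ (D.src a) (D.src a₀)
      exact hpath l a a₀ hl
    refine ⟨g a₀, ?_⟩
    rintro f (rfl | rfl) a
    · exact hconst a
    · rw [← hwb]
      exact hconst a
  · exact ⟨0, fun f _ a => (hA ⟨a⟩).elim⟩

/-- Each ray contributes a perfect matching on which its labels are nonzero. -/
lemma exists_matching_of_face_label
    {ω : Fin d → ℕ} (hω : ∀ f, D.IsFacePerm f → ∀ a, labSum φ (a :: cycleTail f a) = ω)
    {ρ : Fin d} (hρ : 0 < ω ρ) :
    ∃ π : A → ℕ, (∀ a, (φ a).lab ρ = 0 → π a = 0) ∧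
      ∀ f, D.IsFacePerm f → ∀ a, ((a :: cycleTail f a).map π).sum = 1 := by
  classical
  have hsum : ∀ (f : Equiv.Perm A) (h : A → ℕ) (a : A),
      ∑ b with (Quotient.mk (Equiv.Perm.SameCycle.setoid f) b) = Quotient.mk _ a, h b =
        ((a :: cycleTail f a).map h).sum := by
    intro f h a
    rw [sum_cons_cycleTail]
    refine Finset.sum_congr (Finset.filter_congr fun b _ => ?_) fun _ _ => rfl
    rw [Quotient.eq]
    exact Equiv.Perm.sameCycle_comm
  have hfib : ∀ f, D.IsFacePerm f → ∀ q : Quotient (Equiv.Perm.SameCycle.setoid f),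
      ∑ b with (Quotient.mk (Equiv.Perm.SameCycle.setoid f) b) = q, (φ b).lab ρ = ω ρ := by
    intro f hf q
    induction q using Quotient.inductionOn with
    | h a => rw [hsum, ← hω f hf a]; rfl
  obtain ⟨π, hπ, hw, hb⟩ := exists_matching_of_regular
    (Quotient.mk (Equiv.Perm.SameCycle.setoid D.nw))
    (Quotient.mk (Equiv.Perm.SameCycle.setoid D.nb)) (fun a => (φ a).lab ρ) hρ
    (hfib D.nw (Or.inl rfl)) (hfib D.nb (Or.inr rfl))
  refine ⟨π, hπ, ?_⟩
  rintro f (rfl | rfl) a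
  · rw [← hsum, hw]
  · rw [← hsum, hb]

/-- The common label of the faces is the anticanonical divisor. -/
lemma face_label_eq_one (hφ : ∀ a : A, (φ a).src = D.src a ∧ (φ a).tgt = D.tgt a)
    (hiso : ∀ (u w : V) (l l' : List A), D.IsPathFrom u l w → D.IsPathFrom u l' w →
      (labSum φ l = labSum φ l' ↔ FTerm D (u, l) (u, l')))
    {ω : Fin d → ℕ} (hω : ∀ f, D.IsFacePerm f → ∀ a, labSum φ (a :: cycleTail f a) = ω)
    (a : A) (ρ : Fin d) : ω ρ = 1 := by
  have hnw : D.IsFacePerm D.nw := Or.inl rfl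
  have hnb : D.IsFacePerm D.nb := Or.inr rfl
  have hpos : 0 < ω ρ := by
    by_contra h0
    obtain ⟨m, hm⟩ := T.strongly_convex
    obtain ⟨l, -, hl⟩ := exists_cycle_of_nonneg hφ (D.src a) (m := m) fun ρ => (hm ρ).le
    have hzero : labSum φ l ρ = 0 := by
      refine List.sum_eq_zero fun x hx => ?_
      obtain ⟨b, -, rfl⟩ := List.mem_map.1 hx
      have hb := congrFun (hω _ hnw b) ρ
      rw [labSum_cons, Pi.add_apply] at hb
      omega
    have h1 : (labSum φ l ρ : ℤ) = T.iota m ρ := congrFun hl ρ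
    have h2 : 0 < T.iota m ρ := hm ρ
    omega
  obtain ⟨π, hπ, hsum⟩ := exists_matching_of_face_label hω hpos
  have hinv : ∀ b, ((cycleTail D.nw b).map π).sum = ((cycleTail D.nb b).map π).sum := by
    intro b
    have h1 := hsum _ hnw b
    have h2 := hsum _ hnb b
    rw [List.map_cons, List.sum_cons] at h1 h2
    omega
  let u := D.src a
  have hex : ∀ m, ∃ l, (∀ ρ, 0 ≤ T.iota m ρ) →
      D.IsPathFrom u l u ∧ toInt (labSum φ l) = T.iota m := by
    intro m
    by_cases hm : ∀ ρ, 0 ≤ T.iota m ρ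
    · obtain ⟨l, hl⟩ := exists_cycle_of_nonneg hφ u hm
      exact ⟨l, fun _ => hl⟩
    · exact ⟨[], fun h => (hm h).elim⟩
  choose c hc using hex
  have toInt_inj : ∀ x y : Fin d → ℕ, toInt x = toInt y → x = y := fun x y h =>
    funext fun ρ => Int.ofNat_inj.1 (congrFun h ρ)
  have hF : ∀ m, (∀ ρ, 0 ≤ T.iota m ρ) → ∀ l, D.IsPathFrom u l u →
      toInt (labSum φ l) = T.iota m → (l.map π).sum = ((c m).map π).sum := by
    intro m hm l hl e
    obtain ⟨hcm, hcl⟩ := hc m hm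
    exact ((hiso u u l (c m) hl hcm).1 (toInt_inj _ _ (e.trans hcl.symm))).sum_eq hinv
  obtain ⟨k, hk⟩ := T.exists_eq_mul_of_vanish ρ (fun m => ((c m).map π).sum)
    (by
      intro m m' hm hm'
      obtain ⟨h1, h2⟩ := hc m hm
      obtain ⟨h1', h2'⟩ := hc m' hm'
      have hmm : ∀ ρ, 0 ≤ T.iota (m + m') ρ := fun ρ => by
        rw [map_add]
        exact add_nonneg (hm ρ) (hm' ρ)
      rw [← hF _ hmm (c m ++ c m') ((isPathFrom_append _ _ _ _ _).2 ⟨u, h1, h1'⟩),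
        List.map_append, List.sum_append]
      rw [map_add, ← h2, ← h2', labSum_append]
      funext ρ
      simp [toInt])
    (by
      intro m hm h0
      obtain ⟨-, h2⟩ := hc m hm
      have h3 : labSum φ (c m) ρ = 0 := by
        have : (labSum φ (c m) ρ : ℤ) = T.iota m ρ := congrFun h2 ρ
        omega
      refine List.sum_eq_zero fun x hx => ?_
      obtain ⟨b, hb, rfl⟩ := List.mem_map.1 hx
      exact hπ b (List.sum_eq_zero_iff.1 h3 _ (List.mem_map_of_mem hb)))
  have hface := hnw.isPathFrom_cons_cycleTail a
  obtain ⟨m, hm⟩ : ∃ m, T.iota m = toInt ω := by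
    obtain ⟨m, hm⟩ := isSection_labSum hφ hface
    rw [hω _ hnw, sub_self, sub_zero] at hm
    exact ⟨m, hm⟩
  have hmnn : ∀ ρ, 0 ≤ T.iota m ρ := fun ρ => by
    rw [hm]
    exact Int.natCast_nonneg _
  have h1 := hk m hmnn
  rw [← hF m hmnn _ hface (by rw [hω _ hnw, hm]), hsum _ hnw, hm] at h1
  exact Nat.eq_one_of_mul_eq_one_right h1.symm

/-- Every cycle with the label of a face is a face cycle. -/
lemma exists_face_of_cycle (hφ : ∀ a : A, (φ a).src = D.src a ∧ (φ a).tgt = D.tgt a)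
    (hloop : ∀ a, D.src a ≠ D.tgt a)
    (hiso : ∀ (u w : V) (l l' : List A), D.IsPathFrom u l w → D.IsPathFrom u l' w →
      (labSum φ l = labSum φ l' ↔ FTerm D (u, l) (u, l')))
    {ω : Fin d → ℕ} (hω : ∀ f, D.IsFacePerm f → ∀ a, labSum φ (a :: cycleTail f a) = ω)
    (a : A) {l : List A} (hp : D.IsPathFrom (D.src a) l (D.src a)) (hl : labSum φ l = ω) :
    ∃ f c, D.IsFacePerm f ∧ l = c :: cycleTail f c := by
  have hnw : D.IsFacePerm D.nw := Or.inl rfl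
  have h := (hiso _ _ _ _ (hnw.isPathFrom_cons_cycleTail a) hp).1 ((hω _ hnw a).trans hl.symm)
  exact (h.isFace_iff hφ hloop hω).1 ⟨_, a, hnw, rfl⟩

/-- If the two completions of an arrow to a face share their first or their last arrow, then
they coincide. -/
lemma cycleTail_eq_of_shared (hφ : ∀ a : A, (φ a).src = D.src a ∧ (φ a).tgt = D.tgt a)
    (hloop : ∀ a, D.src a ≠ D.tgt a)
    (hiso : ∀ (u w : V) (l l' : List A), D.IsPathFrom u l w → D.IsPathFrom u l' w →
      (labSum φ l = labSum φ l' ↔ FTerm D (u, l) (u, l')))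
    {ω : Fin d → ℕ} (hω : ∀ f, D.IsFacePerm f → ∀ a, labSum φ (a :: cycleTail f a) = ω) (a : A)
    (h : (cycleTail D.nw a).head? = (cycleTail D.nb a).head? ∨
      (cycleTail D.nw a).getLast? = (cycleTail D.nb a).getLast?) :
    cycleTail D.nw a = cycleTail D.nb a := by
  have hnw : D.IsFacePerm D.nw := Or.inl rfl
  have hnb : D.IsFacePerm D.nb := Or.inr rfl
  have hw := hnw.isPathFrom_cycleTail a
  have hb := hnb.isPathFrom_cycleTail a
  have hlw := hω _ hnw a
  have hlb := hω _ hnb a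
  obtain ⟨r, hr⟩ := cycleTail_eq_cons D.nw a fun e => hloop a (by rw [← D.nw_src, e])
  obtain ⟨r', hr'⟩ := cycleTail_eq_cons D.nb a fun e => hloop a (by rw [← D.nb_src, e])
  rcases h with h | h
  · have e : D.nb a = D.nw a := by simpa [hr, hr'] using h.symm
    rw [e] at hr'
    rw [hr] at hw hlw
    rw [hr'] at hb hlb
    rw [hr, hr']
    have hlab : labSum φ r = labSum φ r' := by
      rw [← hlb] at hlw
      simpa only [labSum_cons, add_right_inj] using hlw
    have hF := (hiso _ _ _ _ hw.2 hb.2).1 hlab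
    exact congrArg (D.nw a :: ·)
      ((hF.eq_of_complement hφ hloop hω (u := D.src a) (a := a)).1 ⟨rfl, hw⟩ hlw)
  · obtain ⟨s, c, hs⟩ := (List.eq_nil_or_concat' (cycleTail D.nw a)).resolve_left (by simp [hr])
    obtain ⟨s', c', hs'⟩ := (List.eq_nil_or_concat' (cycleTail D.nb a)).resolve_left
      (by simp [hr'])
    rw [hs] at hw hlw h
    rw [hs'] at hb hlb h
    have e : c = c' := by simpa using h
    subst e
    rw [hs, hs']
    have hlab : labSum φ s = labSum φ s' := by
      rw [← hlb] at hlw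
      simpa only [labSum_cons, labSum_append, add_right_inj, add_left_inj] using hlw
    obtain ⟨x, hsx, hcx⟩ := (isPathFrom_append _ _ _ _ _).1 hw
    obtain ⟨y, hsy, hcy⟩ := (isPathFrom_append _ _ _ _ _).1 hb
    obtain rfl : D.src c = x := hcx.1
    obtain rfl : D.src c = y := hcy.1
    have hF := (hiso _ _ _ _ hsx hsy).1 hlab
    exact congrArg (· ++ [c]) ((hF.eq_of_complement hφ hloop hω (u := D.src c) (a := c) (b := a)).1
      ⟨rfl, hcx.2.symm, hsx⟩ (by
        rw [← hlw]
        simp only [labSum_cons, labSum_append, labSum_nil]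
        abel))

end Labels

end NCCell.DimerStruct

namespace NCCell.Collection

section PathLists

variable {V A : Type} {D : DimerStruct V A} {n d : ℕ} {T : ToricData n d} {C : Collection T V}

/-- The list, in traversal order, of arrows of the dimer quiver underlying a path. -/
def Path.toList (φ : A ≃ C.Arrow) {i : V} : {j : V} → C.Path i j → List A
  | _, .nil _ => []
  | _, .cons p a _ => Path.toList φ p ++ [φ.symm a]

variable {φ : A ≃ C.Arrow}

lemma Path.toList_comp {i j l : V} (p : C.Path i j) (q : C.Path j l) :
    (p.comp q).toList φ = p.toList φ ++ q.toList φ := by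
  induction q with
  | nil => simp [Path.comp, Path.toList]
  | cons q a h ih => simp [Path.comp, Path.toList, ih]

lemma Path.labSum_toList {i j : V} (p : C.Path i j) : labSum φ (p.toList φ) = p.lab := by
  induction p with
  | nil => rfl
  | cons p a h ih =>
    simp [Path.lab, Path.toList, ih, labSum_append, labSum_cons, labSum_nil]

lemma Path.firstArrow?_eq {i j : V} (p : C.Path i j) :
    p.firstArrow? = (p.toList φ).head?.map φ := by
  induction p with
  | nil => rfl
  | cons p a h ih =>
    rw [Path.firstArrow?, ih, Path.toList]
    cases p.toList φ <;> simp

lemma Path.lastArrow?_eq {i j : V} (p : C.Path i j) :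
    p.lastArrow? = (p.toList φ).getLast?.map φ := by
  cases p <;> simp [Path.lastArrow?, Path.toList]

lemma Path.isPathFrom_toList (hφ : ∀ a : A, (φ a).src = D.src a ∧ (φ a).tgt = D.tgt a)
    {i j : V} (p : C.Path i j) : D.IsPathFrom i (p.toList φ) j := by
  induction p with
  | nil => rfl
  | cons p a h ih =>
    rw [Path.toList, isPathFrom_append]
    refine ⟨_, ih, ?_, ?_⟩
    · rw [← (hφ _).1, φ.apply_symm_apply, h]
    · change D.tgt (φ.symm a) = a.tgt
      rw [← (hφ _).2, φ.apply_symm_apply]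

lemma Path.exists_toList_eq (hφ : ∀ a : A, (φ a).src = D.src a ∧ (φ a).tgt = D.tgt a)
    {i j : V} {l : List A} (h : D.IsPathFrom i l j) : ∃ p : C.Path i j, p.toList φ = l := by
  induction l using List.reverseRecOn generalizing j with
  | nil =>
    obtain rfl : i = j := h
    exact ⟨.nil i, rfl⟩
  | append_singleton l a ih =>
    obtain ⟨x, hl, ha, ht⟩ := (isPathFrom_append _ _ _ _ _).1 h
    obtain ⟨p, hp⟩ := ih hl
    obtain rfl : (φ a).tgt = j := (hφ a).2.trans ht
    exact ⟨.cons p (φ a) ((hφ a).1.trans ha), by simp [Path.toList, hp]⟩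

lemma Path.toList_injective {i j : V} {p q : C.Path i j} (h : p.toList φ = q.toList φ) :
    p = q := by
  have key : ∀ {j : V} (p : C.Path i j) {j' : V} (q : C.Path i j'),
      p.toList φ = q.toList φ → j = j' ∧ p ≍ q := by
    intro j p
    induction p with
    | nil =>
      intro j' q h
      cases q with
      | nil => exact ⟨rfl, HEq.rfl⟩
      | cons q a ha => simp [Path.toList] at h
    | cons p a ha ih =>
      intro j' q h
      cases q with
      | nil => simp [Path.toList] at h
      | cons q b hb =>
        obtain ⟨h1, h2⟩ := List.append_inj' h rfl
        obtain rfl : a = b := by simpa using h2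
        obtain ⟨rfl, hpq⟩ := ih q h1
        obtain rfl := eq_of_heq hpq
        exact ⟨rfl, HEq.rfl⟩
  exact eq_of_heq (key p q h).2

lemma Path.lab_comp {i j l : V} (p : C.Path i j) (q : C.Path j l) :
    (p.comp q).lab = p.lab + q.lab := by
  induction q with
  | nil => simp [Path.comp, Path.lab]
  | cons q a h ih => simp [Path.comp, Path.lab, ih, add_assoc]

lemma FTermEquiv.lab_eq {i j : V} {p q : C.Path i j} (h : FTermEquiv p q) : p.lab = q.lab := by
  induction h with
  | rel q₁ q₂ h =>
    obtain ⟨q, hp, hm, -⟩ := h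
    simp only [Path.lab_comp]
    congr 2
    funext ρ
    have := hp ρ
    have := hm ρ
    omega
  | refl p => rfl
  | symm _ ih => exact ih.symm
  | trans _ _ ih ih' => exact ih.trans ih'

variable [Fintype A]

/-- The two completions of an arrow to a face, if distinct, form a superpotential relation. -/
lemma isSPRel_of_toList_eq (hφ : ∀ a : A, (φ a).src = D.src a ∧ (φ a).tgt = D.tgt a)
    (hloop : ∀ a, D.src a ≠ D.tgt a)
    (hiso : ∀ (u w : V) (l l' : List A), D.IsPathFrom u l w → D.IsPathFrom u l' w →
      (labSum φ l = labSum φ l' ↔ FTerm D (u, l) (u, l')))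
    (hω : ∀ f, D.IsFacePerm f → ∀ a, labSum φ (a :: cycleTail f a) = 1) {a : A}
    {p q : C.Path (D.tgt a) (D.src a)} (hp : p.toList φ = cycleTail D.nw a)
    (hq : q.toList φ = cycleTail D.nb a) (hne : p ≠ q) : IsSPRel p q := by
  have hne' : cycleTail D.nw a ≠ cycleTail D.nb a := fun e =>
    hne (Path.toList_injective (hp.trans (e.trans hq.symm)))
  have hinj := Option.map_injective φ.injective
  obtain ⟨r, hr⟩ := Path.exists_toList_eq hφ (l := [a]) (i := D.src a) (j := D.tgt a) ⟨rfl, rfl⟩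
  have hrlab : r.lab = (φ a).lab := by
    rw [← Path.labSum_toList (φ := φ), hr, labSum_cons, labSum_nil, add_zero]
  have sum_eq : ∀ (s : C.Path (D.tgt a) (D.src a)) (ρ : Fin d),
      s.lab ρ + r.lab ρ = labSum φ (a :: s.toList φ) ρ := by
    intro s ρ
    rw [labSum_cons, Path.labSum_toList, hrlab, Pi.add_apply, add_comm]
  refine ⟨r, ?_, ?_, hne, ?_, ?_, ?_⟩
  · intro ρ
    rw [sum_eq, hp, hω _ (Or.inl rfl), Pi.one_apply]
  · intro ρ
    rw [sum_eq, hq, hω _ (Or.inr rfl), Pi.one_apply]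
  · rw [Path.firstArrow?_eq (φ := φ), Path.firstArrow?_eq (φ := φ), hp, hq]
    exact fun e => hne' (cycleTail_eq_of_shared hφ hloop hiso hω a (Or.inl (hinj e)))
  · rw [Path.lastArrow?_eq (φ := φ), Path.lastArrow?_eq (φ := φ), hp, hq]
    exact fun e => hne' (cycleTail_eq_of_shared hφ hloop hiso hω a (Or.inr (hinj e)))
  · intro s hs
    obtain ⟨f, c, hf, e⟩ := exists_face_of_cycle hφ hloop hiso hω a
      (l := a :: s.toList φ) ⟨rfl, s.isPathFrom_toList hφ⟩ (funext fun ρ => by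
        rw [← sum_eq, hs ρ, Pi.one_apply])
    obtain ⟨rfl, e⟩ := List.cons.inj e
    rcases hf with rfl | rfl
    · exact Or.inl (Path.toList_injective (e.trans hp.symm))
    · exact Or.inr (Path.toList_injective (e.trans hq.symm))

lemma fTermEquiv_of_fTerm (hφ : ∀ a : A, (φ a).src = D.src a ∧ (φ a).tgt = D.tgt a)
    (hloop : ∀ a, D.src a ≠ D.tgt a)
    (hiso : ∀ (u w : V) (l l' : List A), D.IsPathFrom u l w → D.IsPathFrom u l' w →
      (labSum φ l = labSum φ l' ↔ FTerm D (u, l) (u, l')))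
    (hω : ∀ f, D.IsFacePerm f → ∀ a, labSum φ (a :: cycleTail f a) = 1)
    {x y : V × List A} (h : FTerm D x y) {i j : V} (p q : C.Path i j)
    (hp : p.toList φ = x.2) (hq : q.toList φ = y.2) : FTermEquiv p q := by
  induction h generalizing p q with
  | rel u l₁ l₂ a =>
    change p.toList φ = l₁ ++ cycleTail D.nw a ++ l₂ at hp
    change q.toList φ = l₁ ++ cycleTail D.nb a ++ l₂ at hq
    have hnw : D.IsFacePerm D.nw := Or.inl rfl
    have hnb : D.IsFacePerm D.nb := Or.inr rfl
    have hpath := p.isPathFrom_toList hφ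
    rw [hp, isPathFrom_append] at hpath
    obtain ⟨z, hpath, h₂⟩ := hpath
    obtain ⟨w, h₁, hc⟩ := (isPathFrom_append _ _ _ _ _).1 hpath
    obtain ⟨rfl, rfl⟩ := (isPathFrom_cycleTail_iff hloop hnw a w z).1 hc
    obtain ⟨p₁, hp₁⟩ := Path.exists_toList_eq hφ h₁
    obtain ⟨p₂, hp₂⟩ := Path.exists_toList_eq hφ h₂
    obtain ⟨s, hs⟩ := Path.exists_toList_eq hφ (hnw.isPathFrom_cycleTail a)
    obtain ⟨t, ht⟩ := Path.exists_toList_eq hφ (hnb.isPathFrom_cycleTail a)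
    obtain rfl : p = (p₁.comp s).comp p₂ := Path.toList_injective (φ := φ) (by
      rw [hp, Path.toList_comp, Path.toList_comp, hp₁, hp₂, hs])
    obtain rfl : q = (p₁.comp t).comp p₂ := Path.toList_injective (φ := φ) (by
      rw [hq, Path.toList_comp, Path.toList_comp, hp₁, hp₂, ht])
    by_cases hst : s = t
    · rw [hst]
      exact .refl _
    · exact .rel _ _ (isSPRel_of_toList_eq hφ hloop hiso hω hs ht hst)
  | refl x =>
    rw [Path.toList_injective (hp.trans hq.symm)]
    exact .refl _
  | symm _ ih => exact (ih q p hq hp).symm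
  | trans h _ ih ih' =>
    have hpath := (h.isPathFrom_iff hloop i j).1 (hp ▸ p.isPathFrom_toList hφ)
    obtain ⟨r, hr⟩ := Path.exists_toList_eq hφ hpath
    exact (ih p r hp hr).trans (ih' r q hr hq)

end PathLists

end NCCell.Collection

/-- Theorem 5.5: for an algebraically consistent dimer model `Γ`
(whose quiver `Q` is the quiver of sections of the collection `𝓔` on
`X = Spec Z(A_Γ)`, with `A_Γ ≅ A_𝓔`), the unsigned dimer superpotential
`W̄_Γ = Σ_{F ∈ Q₂} w_F` coincides with the superpotential `W = Σ_{p anticanonical} p`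
of the collection `𝓔`: every boundary cycle of a face of `Γ` is an anticanonical cycle
of `Q` (`x^{div} = Π_ρ x_ρ`), and conversely every anticanonical cycle of `Q` is the
boundary cycle of a (unique, white or black) face.  In particular `J_W = J_𝓔`, i.e.
the toric algebra `A_𝓔` is consistent. -/
theorem dimer_superpotential_eq_anticanonical_sum
    {V A : Type} [Fintype V] [Fintype A] [DecidableEq V] [DecidableEq A]
    (D : DimerStruct V A) (htor : D.IsTorusDimer) (hcon : D.AlgConsistent)
    {d : ℕ} (T : ToricData 3 d) (hGor : T.Gorenstein)
    (C : Collection T V)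
    (φ : A ≃ C.Arrow)
    (hφ : ∀ a : A, (φ a).src = D.src a ∧ (φ a).tgt = D.tgt a)
    (hiso : ∀ (u w : V) (l l' : List A), D.IsPathFrom u l w → D.IsPathFrom u l' w →
      (labSum φ l = labSum φ l' ↔ FTerm D (u, l) (u, l'))) :
    -- every face boundary cycle is an anticanonical cycle:
    (∀ a : A,
      (D.IsPathFrom (D.src a) (D.wcyc a) (D.src a) ∧ ∀ ρ, labSum φ (D.wcyc a) ρ = 1) ∧
      (D.IsPathFrom (D.src a) (D.bcyc a) (D.src a) ∧ ∀ ρ, labSum φ (D.bcyc a) ρ = 1))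
    -- every anticanonical cycle is the boundary cycle of a face:
    ∧ (∀ (u : V) (l : List A), D.IsPathFrom u l u → (∀ ρ, labSum φ l ρ = 1) →
        ∃ a : A, l = D.wcyc a ∨ l = D.bcyc a)
    -- in particular `J_W = J_𝓔`: the toric algebra `A_𝓔` is consistent:
    ∧ C.Consistent := by
  have hloop := htor.2.2.1
  obtain ⟨ω, hω⟩ := exists_face_label hφ hloop hiso
  have hnw : D.IsFacePerm D.nw := Or.inl rfl
  have hnb : D.IsFacePerm D.nb := Or.inr rfl
  have hω1 : ∀ f, D.IsFacePerm f → ∀ a, labSum φ (a :: cycleTail f a) = 1 := fun f hf a => by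
    rw [hω f hf a]
    exact funext (face_label_eq_one hφ hiso hω a)
  refine ⟨fun a => ⟨⟨hnw.isPathFrom_cons_cycleTail a, congrFun (hω1 _ hnw a)⟩,
    hnb.isPathFrom_cons_cycleTail a, congrFun (hω1 _ hnb a)⟩, ?_, ?_⟩
  · intro u l hp hl
    obtain ⟨a, rfl⟩ := htor.2.1 u
    obtain ⟨f, c, rfl | rfl, rfl⟩ :=
      exists_face_of_cycle hφ hloop hiso hω1 a hp (funext hl)
    · exact ⟨c, Or.inl rfl⟩
    · exact ⟨c, Or.inr rfl⟩
  · refine fun i j p q => ⟨fun h => ?_, FTermEquiv.lab_eq⟩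
    have hF := (hiso i j _ _ (p.isPathFrom_toList hφ) (q.isPathFrom_toList hφ)).1
      (by rw [Path.labSum_toList, Path.labSum_toList, h])
    exact fTermEquiv_of_fTerm hφ hloop hiso hω1 hF p q rfl rfl
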